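/- Let F: GF(2^n) → GF(2^n) have Walsh coefficients W_F(a, b) = Σ_x (-1)^{Tr(aF(x) + bx)} lying in {0, ±2^{(n+s)/2}} for all a ≠ 0 and all b, where 0 ≤ s ≤ n - 1 with n + s even. Then the binary code C(F) = {(Tr(aF(x) + bx) + c)_x : a, b ∈ GF(2^n), c ∈ GF(2)} has length 2^n, dimension 2n + 1, minimum distance 2^{n-1} - 2^{(n+s-2)/2}, and weight distribution: A_{2^{n-1} - 2^{(n+s-2)/2}} = 2^{n-s}(2^n - 1), A_{2^{n-1}} = (2^n - 1)(2^{n+1} - 2^{n-s+1} + 2), A_{2^{n-1} + 2^{(n+s-2)/2}} = 2^{n-s}(2^n - 1), A_{2^n} = 1, and A_i = 0 for all other nonzero i. -/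

import Mathlib

open Finset

variable {F : Type*} [Field F] {ι : Type*} [Fintype ι]

/-- Hamming weight of a vector. -/
noncomputable def wt (c : ι → F) : ℕ := Nat.card {i : ι // c i ≠ 0}

/-- Number of codewords of weight `k` in a linear code `C`. -/
noncomputable def Acount (C : Submodule F (ι → F)) (k : ℕ) : ℕ :=
  Nat.card {c : C // wt (c : ι → F) = k}

/-- `d` is the minimum (Hamming) distance of the code `C`. -/
def IsMinDist (C : Submodule F (ι → F)) (d : ℕ) : Prop :=
  (∃ c ∈ C, c ≠ 0 ∧ wt c = d) ∧ ∀ c ∈ C, c ≠ 0 → d ≤ wt c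

/-- The dual code with respect to the standard inner product. -/
def dualCode (C : Submodule F (ι → F)) : Submodule F (ι → F) where
  carrier := {x | ∀ c ∈ C, ∑ i, x i * c i = 0}
  add_mem' := by
    intro x y hx hy c hc
    simp only [Set.mem_setOf_eq] at *
    simp [Pi.add_apply, add_mul, Finset.sum_add_distrib, hx c hc, hy c hc]
  zero_mem' := by simp
  smul_mem' := by
    intro a x hx c hc
    simp only [Set.mem_setOf_eq] at *
    simp [Pi.smul_apply, smul_eq_mul, mul_assoc, ← Finset.mul_sum, hx c hc]

/-- The submodule of vectors vanishing on `T`. -/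
def vanishOn (T : Finset ι) : Submodule F (ι → F) where
  carrier := {x | ∀ i ∈ T, x i = 0}
  add_mem' := by
    intro x y hx hy i hi
    simp [hx i hi, hy i hi]
  zero_mem' := by intro i _; rfl
  smul_mem' := by
    intro a x hx i hi
    simp [hx i hi]

/-- The punctured code: delete the coordinates in `T`. -/
def punctured (C : Submodule F (ι → F)) (T : Finset ι) :
    Submodule F ({i : ι // i ∉ T} → F) :=
  C.map (LinearMap.funLeft F F (Subtype.val : {i : ι // i ∉ T} → ι))

/-- The shortened code: codewords vanishing on `T`, with the coordinates in `T` deleted. -/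
def shortened (C : Submodule F (ι → F)) (T : Finset ι) :
    Submodule F ({i : ι // i ∉ T} → F) :=
  punctured (C ⊓ vanishOn T) T

/-- The supports of the weight-`k` codewords of `C` (with multiplicities divided by `q-1`)
form a `t`-design: every `t`-set of coordinates lies in the same number of supports. -/
def SupportsDesign [Fintype F] (t : ℕ) (C : Submodule F (ι → F)) (k : ℕ) : Prop :=
  ∃ lam : ℕ, ∀ T : Finset ι, T.card = t →
    Nat.card {c : C // wt (c : ι → F) = k ∧ ∀ i ∈ T, (c : ι → F) i ≠ 0} =
      (Fintype.card F - 1) * lam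

/-- `(P, B)` is a `t`-`(v, k, lam)` design (with `v = Fintype.card P`). -/
def IsBlockDesign (t k lam : ℕ) {P : Type*} [Fintype P] [DecidableEq P]
    (B : Multiset (Finset P)) : Prop :=
  (∀ b ∈ B, b.card = k) ∧
  ∀ T : Finset P, T.card = t → B.countP (fun b => T ⊆ b) = lam

/-- The additive character `(-1)^y` of `ZMod 2` with values in `ℤ`. -/
def chi : ZMod 2 → ℤ := fun y => if y = 0 then 1 else -1

lemma zmod_two_aux : ∀ y : ZMod 2, y ≠ 1 → y = 0 := by decide

lemma zmod_two_cases : ∀ y : ZMod 2, y = 0 ∨ y = 1 := by decide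

lemma chi_cases : ∀ y : ZMod 2, chi y = 1 ∨ chi y = -1 := by decide

lemma ite_aux_one (W v M : ℤ) (hM : 0 < M) (hW : W = 0 ∨ W = 2 * M ∨ W = -(2 * M))
    (hv : v = 2 * M ∨ v = -(2 * M)) :
    ((if 1 * W = v then (1 : ℤ) else 0) + (if -1 * W = v then 1 else 0)) * (4 * (M * M)) =
      W ^ 2 := by
  rcases hW with rfl | rfl | rfl <;> rcases hv with rfl | rfl <;> split_ifs <;>
    first | (exfalso; omega) | ring

lemma ite_aux_zero (W M : ℤ) (hM : 0 < M) (hW : W = 0 ∨ W = 2 * M ∨ W = -(2 * M)) :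
    ((if 1 * W = 0 then (1 : ℤ) else 0) + (if -1 * W = 0 then 1 else 0)) * (4 * (M * M)) =
      2 * (4 * (M * M) - W ^ 2) := by
  rcases hW with rfl | rfl | rfl <;> split_ifs <;>
    first | (exfalso; omega) | ring

lemma wt_aux (w P Q : ℕ) (W x : ℤ) (hQP : Q ≤ P) (hx : x = 1 ∨ x = -1)
    (hW : W = 0 ∨ W = 2 * (Q : ℤ) ∨ W = -(2 * (Q : ℤ))) (h : x * W = 2 * (P : ℤ) - 2 * w) :
    w = P - Q ∨ w = P ∨ w = P + Q := by
  rcases hx with rfl | rfl <;> rcases hW with rfl | rfl | rfl <;> omega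

lemma wt_le_aux (w P Q N : ℕ) (hN : P + P = N)
    (h : w = P - Q ∨ w = P ∨ w = P + Q ∨ w = N) : P - Q ≤ w := by
  omega

lemma chi_add (u v : ZMod 2) : chi (u + v) = chi u * chi v := by
  revert u v; decide

lemma chi_zero : chi 0 = 1 := by decide

lemma chi_one : chi 1 = -1 := by decide

lemma chi_sq (u : ZMod 2) : chi u * chi u = 1 := by
  revert u; decide

/-- The character sum of a word determines its weight. -/
lemma sum_chi_eq {κ : Type*} [Fintype κ] (c : κ → ZMod 2) :
    ∑ x, chi (c x) = (Fintype.card κ : ℤ) - 2 * (wt c : ℤ) := by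
  classical
  have h : ∀ x, chi (c x) = 1 - 2 * (if c x ≠ 0 then 1 else 0) := by
    intro x
    unfold chi
    by_cases hx : c x = 0 <;> simp [hx]
  have hw : (wt c : ℤ) = ∑ x, (if c x ≠ 0 then (1 : ℤ) else 0) := by
    unfold wt
    rw [Nat.card_eq_fintype_card, Fintype.card_subtype, Finset.card_filter]
    push_cast
    rfl
  rw [Finset.sum_congr rfl (fun x _ => h x), hw, Finset.sum_sub_distrib, ← Finset.mul_sum]
  simp

section Walsh

variable {K : Type*} [Field K] [Fintype K] [Algebra (ZMod 2) K]

/-- Orthogonality of characters. -/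
lemma sum_chi_trace (z : K) (hz : z ≠ 0) :
    ∑ b : K, chi (Algebra.trace (ZMod 2) K (b * z)) = 0 := by
  obtain ⟨d, hd⟩ : ∃ d : K, Algebra.trace (ZMod 2) K (d * z) = 1 := by
    have : Fact (Nat.Prime 2) := ⟨Nat.prime_two⟩
    have : CharP K 2 := charP_of_injective_algebraMap (algebraMap (ZMod 2) K).injective 2
    by_contra hcon
    push Not at hcon
    apply hz
    have hnd := traceForm_nondegenerate (ZMod 2) K
    refine hnd.1 z ?_
    intro d
    rw [Algebra.traceForm_apply, mul_comm]
    exact zmod_two_aux _ (hcon d)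
  have h : ∑ b : K, chi (Algebra.trace (ZMod 2) K (b * z)) =
      -∑ b : K, chi (Algebra.trace (ZMod 2) K (b * z)) := by
    conv_lhs => rw [← Equiv.sum_comp (Equiv.addRight d)]
    rw [← Finset.sum_neg_distrib]
    refine Finset.sum_congr rfl fun b _ => ?_
    simp only [Equiv.coe_addRight, add_mul, map_add, chi_add, hd, chi_one]
    ring
  linarith

/-- The Walsh transform. -/
noncomputable def walsh (Fv : K → K) (a b : K) : ℤ :=
  ∑ x : K, chi (Algebra.trace (ZMod 2) K (a * Fv x + b * x))

/-- Parseval. -/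
lemma parseval (Fv : K → K) (a : K) :
    ∑ b : K, walsh Fv a b ^ 2 = (Fintype.card K : ℤ) ^ 2 := by
  classical
  have : CharP K 2 := charP_of_injective_algebraMap (algebraMap (ZMod 2) K).injective 2
  have h1 : ∀ b : K, walsh Fv a b ^ 2 = ∑ x : K, ∑ y : K,
      chi (Algebra.trace (ZMod 2) K (a * Fv x + a * Fv y)) *
        chi (Algebra.trace (ZMod 2) K (b * (x + y))) := by
    intro b
    rw [sq, walsh, Finset.sum_mul_sum]
    refine Finset.sum_congr rfl fun x _ => Finset.sum_congr rfl fun y _ => ?_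
    rw [← chi_add, ← chi_add, ← map_add, ← map_add]
    congr 2
    ring
  rw [Finset.sum_congr rfl fun b _ => h1 b, Finset.sum_comm]
  have h2 : ∀ x : K, ∑ b : K, ∑ y : K,
      chi (Algebra.trace (ZMod 2) K (a * Fv x + a * Fv y)) *
        chi (Algebra.trace (ZMod 2) K (b * (x + y))) = (Fintype.card K : ℤ) := by
    intro x
    rw [Finset.sum_comm, Finset.sum_eq_single x]
    · simp [CharTwo.add_self_eq_zero, chi_zero]
    · intro y _ hy
      rw [← Finset.mul_sum, sum_chi_trace, mul_zero]
      intro h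
      exact hy (CharTwo.add_eq_zero.mp h).symm
    · simp
  rw [Finset.sum_congr rfl fun x _ => h2 x]
  simp [sq]

lemma walsh_zero (Fv : K → K) (b : K) (hb : b ≠ 0) : walsh Fv 0 b = 0 := by
  have := sum_chi_trace b hb
  rw [← this, walsh]
  refine Finset.sum_congr rfl fun x _ => ?_
  rw [zero_mul, zero_add, mul_comm]

lemma walsh_zero_zero (Fv : K → K) : walsh Fv 0 0 = (Fintype.card K : ℤ) := by
  simp [walsh, chi_zero]

/-- The encoding map. -/
noncomputable def enc (Fv : K → K) : (K × K × ZMod 2) →ₗ[ZMod 2] (K → ZMod 2) where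
  toFun p := fun x => Algebra.trace (ZMod 2) K (p.1 * Fv x + p.2.1 * x) + p.2.2
  map_add' p q := by
    funext x
    simp only [Prod.fst_add, Prod.snd_add, add_mul, map_add, Pi.add_apply]
    ring
  map_smul' r p := by
    funext x
    simp only [Prod.smul_fst, Prod.smul_snd, smul_mul_assoc, map_add, map_smul, Pi.smul_apply,
      RingHom.id_apply, smul_add]

lemma sum_chi_enc (Fv : K → K) (p : K × K × ZMod 2) :
    ∑ x, chi (enc Fv p x) = chi p.2.2 * walsh Fv p.1 p.2.1 := by
  rw [walsh, Finset.mul_sum]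
  refine Finset.sum_congr rfl fun x _ => ?_
  change chi (_ + _) = _
  rw [chi_add, mul_comm]

lemma wt_enc (Fv : K → K) (p : K × K × ZMod 2) :
    chi p.2.2 * walsh Fv p.1 p.2.1 = (Fintype.card K : ℤ) - 2 * (wt (enc Fv p) : ℤ) := by
  rw [← sum_chi_enc, sum_chi_eq]

open Classical in
lemma acount_enc (Fv : K → K) (hinj : Function.Injective (enc Fv)) (k : ℕ) :
    (Acount (LinearMap.range (enc Fv)) k : ℤ) =
      ∑ a : K, ∑ b : K, ∑ c : ZMod 2,
        if chi c * walsh Fv a b = (Fintype.card K : ℤ) - 2 * k then 1 else 0 := by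
  have e : {p : K × K × ZMod 2 // chi p.2.2 * walsh Fv p.1 p.2.1 =
        (Fintype.card K : ℤ) - 2 * k} ≃
      {c : LinearMap.range (enc Fv) // wt (c : K → ZMod 2) = k} := by
    refine Equiv.subtypeEquiv (LinearEquiv.ofInjective (enc Fv) hinj).toEquiv ?_
    intro p
    rw [wt_enc]
    change _ ↔ wt (enc Fv p) = k
    omega
  unfold Acount
  rw [← Nat.card_congr e, Nat.card_eq_fintype_card, Fintype.card_subtype, Finset.card_filter]
  push_cast
  rw [Fintype.sum_prod_type]
  refine Finset.sum_congr rfl fun a _ => ?_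
  rw [Fintype.sum_prod_type]

end Walsh

lemma sum_zmod_two (f : ZMod 2 → ℤ) : ∑ c, f c = f 0 + f 1 := Fin.sum_univ_two f

set_option maxHeartbeats 1000000 in
/-- if all Walsh coefficients of `F` at `a ≠ 0` lie in
`{0, ±2^{(n+s)/2}}`, then `C(F)` is a `[2^n, 2n+1, 2^{n-1} - 2^{(n+s-2)/2}]` binary code
with the stated weight distribution. -/
theorem code_of_plateaued (n s : ℕ) (hn : 0 < n) (hs : s ≤ n - 1) (hpar : Even (n + s))
    (K : Type*) [Field K] [Fintype K] [Algebra (ZMod 2) K]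
    (hK : Fintype.card K = 2 ^ n) (Fv : K → K)
    (hW : ∀ a b : K, a ≠ 0 →
      (∑ x : K, chi (Algebra.trace (ZMod 2) K (a * Fv x + b * x))) = 0 ∨
      (∑ x : K, chi (Algebra.trace (ZMod 2) K (a * Fv x + b * x))) = 2 ^ ((n + s) / 2) ∨
      (∑ x : K, chi (Algebra.trace (ZMod 2) K (a * Fv x + b * x))) = -(2 ^ ((n + s) / 2)))
    (CF : Submodule (ZMod 2) (K → ZMod 2))
    (hCF : CF = Submodule.span (ZMod 2) (Set.range fun p : K × K × ZMod 2 =>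
      fun x : K => Algebra.trace (ZMod 2) K (p.1 * Fv x + p.2.1 * x) + p.2.2)) :
    Module.finrank (ZMod 2) CF = 2 * n + 1 ∧
    IsMinDist CF (2 ^ (n - 1) - 2 ^ ((n + s - 2) / 2)) ∧
    Acount CF (2 ^ (n - 1) - 2 ^ ((n + s - 2) / 2)) = 2 ^ (n - s) * (2 ^ n - 1) ∧
    Acount CF (2 ^ (n - 1)) = (2 ^ n - 1) * (2 ^ (n + 1) - 2 ^ (n - s + 1) + 2) ∧
    Acount CF (2 ^ (n - 1) + 2 ^ ((n + s - 2) / 2)) = 2 ^ (n - s) * (2 ^ n - 1) ∧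
    Acount CF (2 ^ n) = 1 ∧
    ∀ i : ℕ, 0 < i → i ≠ 2 ^ (n - 1) - 2 ^ ((n + s - 2) / 2) → i ≠ 2 ^ (n - 1) →
      i ≠ 2 ^ (n - 1) + 2 ^ ((n + s - 2) / 2) → i ≠ 2 ^ n → Acount CF i = 0 := by
  classical
  -- parameters
  obtain ⟨m, t, hm, hn2⟩ : ∃ m t, n + s = 2 * (m + 1) ∧ n = m + 2 + t := by
    obtain ⟨r, hr⟩ := hpar
    exact ⟨r - 1, n - r - 1, by omega, by omega⟩
  have e1 : (n + s) / 2 = m + 1 := by omega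
  have e2 : (n + s - 2) / 2 = m := by omega
  have e3 : n - 1 = m + 1 + t := by omega
  rw [e1] at hW
  rw [e2, e3]
  change ∀ a b : K, a ≠ 0 → walsh Fv a b = 0 ∨ walsh Fv a b = 2 ^ (m + 1) ∨
    walsh Fv a b = -(2 ^ (m + 1)) at hW
  have hq : (Fintype.card K : ℤ) = 4 * 2 ^ m * 2 ^ t := by
    rw [hK, hn2]; push_cast; ring
  have hM : (0 : ℤ) < 2 ^ m := by positivity
  have hT : (1 : ℤ) ≤ 2 ^ t := one_le_pow₀ (by norm_num)
  have hMT : (2 : ℤ) ^ m ≤ 2 ^ m * 2 ^ t := by nlinarith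
  have hW' : ∀ a b : K, a ≠ 0 → walsh Fv a b = 0 ∨ walsh Fv a b = 2 * 2 ^ m ∨
      walsh Fv a b = -(2 * 2 ^ m) := by
    intro a b ha
    have := hW a b ha
    rwa [pow_succ, mul_comm] at this
  clear hW
  -- weights
  have hwt : ∀ p : K × K × ZMod 2, p ≠ 0 →
      (wt (enc Fv p) = 2 ^ (m + 1 + t) - 2 ^ m ∨ wt (enc Fv p) = 2 ^ (m + 1 + t) ∨
        wt (enc Fv p) = 2 ^ (m + 1 + t) + 2 ^ m ∨ wt (enc Fv p) = 2 ^ n) := by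
    rintro ⟨a, b, c⟩ hp
    have hw := wt_enc Fv (a, b, c)
    have hle : 2 ^ m ≤ 2 ^ (m + 1 + t) := Nat.pow_le_pow_right (by norm_num) (by omega)
    have hz : ((2 ^ (m + 1 + t) : ℕ) : ℤ) = 2 * (2 ^ m * 2 ^ t) := by push_cast; ring
    have hz2 : ((2 ^ m : ℕ) : ℤ) = 2 ^ m := by push_cast; ring
    have hz3 : ((2 ^ n : ℕ) : ℤ) = 4 * (2 ^ m * 2 ^ t) := by rw [hn2]; push_cast; ring
    rw [hq] at hw
    have hc : chi c = 1 ∨ chi c = -1 := chi_cases c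
    by_cases ha : a = 0
    · subst ha
      by_cases hb : b = 0
      · subst hb
        have hc1 : c = 1 := by
          have : c ≠ 0 := by rintro rfl; exact hp rfl
          exact (zmod_two_cases c).resolve_left this
        subst hc1
        simp only [walsh_zero_zero, chi_one, hq] at hw
        right; right; right
        zify
        push_cast at hz3
        linarith
      · simp only [walsh_zero Fv b hb] at hw
        right; left
        zify
        push_cast at hz
        linarith
    · have := wt_aux (wt (enc Fv (a, b, c))) (2 ^ (m + 1 + t)) (2 ^ m) (walsh Fv a b) (chi c)
        hle hc (by rw [hz2]; exact hW' a b ha) (by rw [hz]; simp only at hw; rw [hw]; ring)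
      tauto
  have hbounds : 2 ^ m + 1 ≤ 2 ^ (m + 1 + t) ∧ 2 ^ (m + 1 + t) + 2 ^ (m + 1 + t) = 2 ^ n := by
    have h1 : 1 ≤ 2 ^ m := Nat.one_le_two_pow
    have h2 : 2 ^ (m + 1) ≤ 2 ^ (m + 1 + t) := Nat.pow_le_pow_right (by norm_num) (by omega)
    constructor
    · rw [pow_succ] at h2; omega
    · rw [hn2]; ring
  have hwpos : ∀ p : K × K × ZMod 2, p ≠ 0 → 2 ^ (m + 1 + t) - 2 ^ m ≤ wt (enc Fv p) := by
    intro p hp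
    exact wt_le_aux _ _ _ _ hbounds.2 (hwt p hp)
  have hwt0 : wt (0 : K → ZMod 2) = 0 := by simp [wt]
  have hinj : Function.Injective (enc Fv) := by
    rw [← LinearMap.ker_eq_bot, LinearMap.ker_eq_bot']
    intro p hp
    by_contra hne
    have := hwpos p hne
    rw [hp, hwt0] at this
    omega
  have hrange : CF = LinearMap.range (enc Fv) := by
    rw [hCF]
    change Submodule.span (ZMod 2) (Set.range (enc Fv)) = _
    rw [← LinearMap.coe_range, Submodule.span_eq]
  clear hCF
  subst hrange
  -- counts
  have hcount := acount_enc Fv hinj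
  have hpars := parseval Fv
  have hcardK : (Fintype.card K : ℤ) = 2 ^ n := by rw [hK]; push_cast; rfl
  have hns : 2 ^ (n - s) * (4 * (2 ^ m * 2 ^ m)) = (4 * 2 ^ m * 2 ^ t : ℤ) ^ 2 := by
    have : n - s = 2 * t + 2 := by omega
    rw [this]; ring
  have hcne : ∀ f : K → ℤ, ∀ A B : ℤ, f 0 = A → (∀ a, a ≠ 0 → f a = B) →
      ∑ a, f a = A + (2 ^ n - 1) * B := by
    intro f A B h0 h1
    rw [← Finset.add_sum_erase _ _ (Finset.mem_univ (0 : K)), h0,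
      Finset.sum_congr rfl (fun a ha => h1 a (Finset.ne_of_mem_erase ha))]
    rw [Finset.sum_const, Finset.card_erase_of_mem (Finset.mem_univ _), Finset.card_univ,
      nsmul_eq_mul, Nat.cast_sub Fintype.card_pos, hcardK]
    simp
  have key1 : ∀ v : ℤ, (v = 2 * 2 ^ m ∨ v = -(2 * 2 ^ m)) →
      (∑ a : K, ∑ b : K, ∑ c : ZMod 2, if chi c * walsh Fv a b = v then (1 : ℤ) else 0) =
        2 ^ (n - s) * (2 ^ n - 1) := by
    intro v hv
    rw [hcne _ 0 (2 ^ (n - s))]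
    · ring
    · apply Finset.sum_eq_zero
      intro b _
      rw [sum_zmod_two, chi_zero, chi_one]
      by_cases hb : b = 0
      · subst hb
        rw [walsh_zero_zero, hq, if_neg, if_neg, add_zero] <;> rcases hv with h | h <;>
          rw [h] <;> intro h <;> nlinarith
      · rw [walsh_zero Fv b hb, if_neg, if_neg, add_zero] <;> rcases hv with h | h <;>
          rw [h] <;> intro h <;> nlinarith
    · intro a ha
      have h4 : (4 * (2 ^ m * 2 ^ m) : ℤ) ≠ 0 := by positivity
      apply mul_right_cancel₀ h4
      rw [hns, ← hq, ← hpars a, Finset.sum_mul]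
      refine Finset.sum_congr rfl fun b _ => ?_
      rw [sum_zmod_two, chi_zero, chi_one]
      exact ite_aux_one _ _ _ hM (hW' a b ha) hv
  have key0 :
      (∑ a : K, ∑ b : K, ∑ c : ZMod 2, if chi c * walsh Fv a b = 0 then (1 : ℤ) else 0) =
        (2 ^ n - 1) * (2 ^ (n + 1) - 2 ^ (n - s + 1) + 2) := by
    rw [hcne _ ((2 ^ n - 1) * 2) (2 * (2 ^ n - 2 ^ (n - s)))]
    · ring
    · have := hcne (fun b => ∑ c : ZMod 2, if chi c * walsh Fv 0 b = 0 then (1 : ℤ) else 0) 0 2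
        ?_ ?_
      · rw [this]; ring
      · simp only [sum_zmod_two, chi_zero, chi_one]
        rw [walsh_zero_zero, hq, if_neg, if_neg, add_zero] <;> intro h <;> nlinarith
      · intro b hb
        simp only [sum_zmod_two, chi_zero, chi_one]
        rw [walsh_zero Fv b hb]; norm_num
    · intro a ha
      have h4 : (4 * (2 ^ m * 2 ^ m) : ℤ) ≠ 0 := by positivity
      apply mul_right_cancel₀ h4
      have : 2 * (2 ^ n - 2 ^ (n - s)) * (4 * (2 ^ m * 2 ^ m) : ℤ) =
          2 * ((Fintype.card K : ℤ) * (4 * (2 ^ m * 2 ^ m)) - ∑ b : K, walsh Fv a b ^ 2) := by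
        rw [hpars a, hcardK, ← hcardK, hq, ← hns]; ring
      rw [this, Finset.sum_mul]
      have h5 : (Fintype.card K : ℤ) * (4 * (2 ^ m * 2 ^ m)) =
          ∑ b : K, (4 * (2 ^ m * 2 ^ m) : ℤ) := by simp
      rw [h5, ← Finset.sum_sub_distrib, Finset.mul_sum]
      refine Finset.sum_congr rfl fun b _ => ?_
      rw [sum_zmod_two, chi_zero, chi_one]
      exact ite_aux_zero _ _ hM (hW' a b ha)
  have hple : 2 ^ m ≤ 2 ^ (m + 1 + t) := by omega
  have hz1 : ((2 ^ (m + 1 + t) : ℕ) : ℤ) = 2 * (2 ^ m * 2 ^ t) := by push_cast; ring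
  have hz2 : ((2 ^ m : ℕ) : ℤ) = 2 ^ m := by push_cast; ring
  have hA1 : Acount (LinearMap.range (enc Fv)) (2 ^ (m + 1 + t) - 2 ^ m) =
      2 ^ (n - s) * (2 ^ n - 1) := by
    zify [Nat.one_le_two_pow (n := n)]
    rw [hcount, key1]
    left
    rw [Nat.cast_sub hple, hz1, hz2, hq]; ring
  refine ⟨?_, ⟨?_, ?_⟩, hA1, ?_, ?_, ?_, ?_⟩
  · rw [LinearMap.finrank_range_of_inj hinj]
    have hf : Module.finrank (ZMod 2) K = n := by
      have := Module.card_eq_pow_finrank (K := ZMod 2) (V := K)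
      rw [hK, ZMod.card] at this
      exact (Nat.pow_right_injective (le_refl 2) this).symm
    rw [Module.finrank_prod, Module.finrank_prod, hf, Module.finrank_self]
    ring
  · have hpos : 0 < Acount (LinearMap.range (enc Fv)) (2 ^ (m + 1 + t) - 2 ^ m) := by
      rw [hA1]
      have : 1 < 2 ^ n := Nat.one_lt_two_pow (by omega)
      exact Nat.mul_pos (by positivity) (by omega)
    unfold Acount at hpos
    obtain ⟨⟨⟨c, hc⟩, hc2⟩⟩ := (Nat.card_pos_iff.mp hpos).1
    refine ⟨c, hc, ?_, hc2⟩
    rintro rfl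
    simp only [hwt0] at hc2
    omega
  · rintro _ ⟨p, rfl⟩ hne
    apply hwpos
    rintro rfl
    simp at hne
  · have hle : 2 ^ (n - s + 1) ≤ 2 ^ (n + 1) := Nat.pow_le_pow_right (by norm_num) (by omega)
    zify [Nat.one_le_two_pow (n := n), hle]
    rw [hcount, ← key0]
    have : (Fintype.card K : ℤ) - 2 * ((2 ^ (m + 1 + t) : ℕ) : ℤ) = 0 := by
      rw [hz1, hq]; ring
    rw [this]
  · zify [Nat.one_le_two_pow (n := n)]
    rw [hcount, key1]
    right
    rw [Nat.cast_add, hz1, hz2, hq]; ring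
  · unfold Acount
    rw [Nat.card_eq_one_iff_unique]
    have hone : ∀ p : K × K × ZMod 2, wt (enc Fv p) = 2 ^ n ↔ p = (0, 0, 1) := by
      rintro ⟨a, b, c⟩
      have hw := wt_enc Fv (a, b, c)
      have hc : c = 0 ∨ c = 1 := zmod_two_cases c
      have hz3 : ((2 ^ n : ℕ) : ℤ) = 4 * (2 ^ m * 2 ^ t) := by rw [hn2]; push_cast; ring
      rw [hq] at hw
      constructor
      · intro h
        rw [h, hz3] at hw
        by_cases ha : a = 0
        · subst ha
          by_cases hb : b = 0
          · subst hb
            rcases hc with rfl | rfl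
            · simp only [walsh_zero_zero, chi_zero, hq] at hw
              exfalso; nlinarith
            · rfl
          · simp only [walsh_zero Fv b hb] at hw
            exfalso; nlinarith
        · exfalso
          rcases hc with rfl | rfl <;> rcases hW' a b ha with h | h | h <;>
            simp only [h, chi_zero, chi_one] at hw <;> nlinarith
      · intro h
        obtain ⟨rfl, rfl, rfl⟩ : a = 0 ∧ b = 0 ∧ c = 1 := by simpa using h
        simp only [walsh_zero_zero, chi_one, hq] at hw
        zify
        push_cast at hz3
        linarith
    constructor
    · constructor
      rintro ⟨⟨_, p, rfl⟩, hp⟩ ⟨⟨_, p', rfl⟩, hp'⟩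
      have h1 := (hone p).mp hp
      have h2 := (hone p').mp hp'
      subst h1; subst h2; rfl
    · exact ⟨⟨⟨enc Fv (0, 0, 1), ⟨_, rfl⟩⟩, (hone _).mpr rfl⟩⟩
  · intro i hi h1 h2 h3 h4
    unfold Acount
    rw [Nat.card_eq_zero]
    left
    constructor
    rintro ⟨⟨_, p, rfl⟩, hp⟩
    simp only at hp
    by_cases hp0 : p = 0
    · subst hp0
      rw [map_zero, hwt0] at hp
      omega
    · rcases hwt p hp0 with h | h | h | h <;> omega
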